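/- arXiv:2305.17241 — 2 statements merged into one kernel-verified Lean document; each statement's English description precedes it below -/
import Mathlib

section
/- (Radial Pythagorean theorem) Let V be a real Hilbert space and G ≤ O(V). For all unit vectors u, v ∈ V and all a, b ≥ 0, the quotient metric satisfies d([au],[bv])² = (a−b)² + a·b·d([u],[v])². -/
/-- The orbit of `x` under a subgroup `G` of the orthogonal group of `V`. -/
def orbG {V : Type*} [NormedAddCommGroup V] [InnerProductSpace ℝ V]
    (G : Subgroup (V ≃ₗᵢ[ℝ] V)) (x : V) : Set V :=
  {y | ∃ g ∈ G, g x = y}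

/-- The metric-quotient distance `d([x],[y]) = inf_{p ∈ [x], q ∈ [y]} ‖p − q‖`, where
`[x]` is the closure of the orbit `G·x`. -/
noncomputable def qd {V : Type*} [NormedAddCommGroup V] [InnerProductSpace ℝ V]
    (G : Subgroup (V ≃ₗᵢ[ℝ] V)) (x y : V) : ℝ :=
  sInf {r : ℝ | ∃ p ∈ closure (orbG G x), ∃ q ∈ closure (orbG G y), r = dist p q}

open scoped Pointwise

theorem mem_orbG_self {V : Type*} [NormedAddCommGroup V] [InnerProductSpace ℝ V]
    (G : Subgroup (V ≃ₗᵢ[ℝ] V)) (x : V) : x ∈ orbG G x :=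
  ⟨1, G.one_mem, rfl⟩

theorem orbG_smul {V : Type*} [NormedAddCommGroup V] [InnerProductSpace ℝ V]
    (G : Subgroup (V ≃ₗᵢ[ℝ] V)) (c : ℝ) (x : V) : orbG G (c • x) = c • orbG G x := by
  ext y
  simp [orbG, Set.mem_smul_set]

theorem norm_eq_of_mem_closure_orbG {V : Type*} [NormedAddCommGroup V] [InnerProductSpace ℝ V]
    {G : Subgroup (V ≃ₗᵢ[ℝ] V)} {x p : V} (hp : p ∈ closure (orbG G x)) : ‖p‖ = ‖x‖ := by
  have hcl : IsClosed {y : V | ‖y‖ = ‖x‖} := isClosed_eq continuous_norm continuous_const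
  refine closure_minimal ?_ hcl hp
  rintro _ ⟨g, -, rfl⟩
  exact g.norm_map x

theorem dist_smul_smul_sq_of_norm_eq_one {V : Type*} [NormedAddCommGroup V]
    [InnerProductSpace ℝ V] {p q : V} (hp : ‖p‖ = 1) (hq : ‖q‖ = 1) (a b : ℝ) :
    dist (a • p) (b • q) ^ 2 = (a - b) ^ 2 + a * b * dist p q ^ 2 := by
  rw [dist_eq_norm, dist_eq_norm, norm_sub_sq_real, norm_sub_sq_real, norm_smul, norm_smul,
    real_inner_smul_left, real_inner_smul_right, hp, hq, mul_one, mul_one, Real.norm_eq_abs,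
    Real.norm_eq_abs, sq_abs, sq_abs]
  ring

/-- radial Pythagorean theorem: for unit vectors `u, v` and `a, b ≥ 0`,
`d([au],[bv])² = (a−b)² + a·b·d([u],[v])²`. -/
theorem radial_pythagorean
    {V : Type*} [NormedAddCommGroup V] [InnerProductSpace ℝ V] [CompleteSpace V]
    (G : Subgroup (V ≃ₗᵢ[ℝ] V)) (u v : V) (hu : ‖u‖ = 1) (hv : ‖v‖ = 1)
    (a b : ℝ) (ha : 0 ≤ a) (hb : 0 ≤ b) :
    (qd G (a • u) (b • v)) ^ 2 = (a - b) ^ 2 + a * b * (qd G u v) ^ 2 := by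
  set f : ℝ → ℝ := fun r ↦ √((a - b) ^ 2 + a * b * max r 0 ^ 2) with hf
  have hab : 0 ≤ a * b := mul_nonneg ha hb
  have hmono : Monotone f := fun r s hrs ↦ by
    simp only [hf]
    gcongr
  have hcont : Continuous f := by fun_prop
  have hdist : ∀ p ∈ closure (orbG G u), ∀ q ∈ closure (orbG G v),
      f (dist p q) = dist (a • p) (b • q) := fun p hp q hq ↦ by
    simp only [hf]
    rw [max_eq_left dist_nonneg, ← dist_smul_smul_sq_of_norm_eq_one
      ((norm_eq_of_mem_closure_orbG hp).trans hu) ((norm_eq_of_mem_closure_orbG hq).trans hv),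
      Real.sqrt_sq dist_nonneg]
  have hqd : 0 ≤ qd G u v := Real.sInf_nonneg (by
    rintro _ ⟨p, -, q, -, rfl⟩
    exact dist_nonneg)
  have key : qd G (a • u) (b • v) = f (qd G u v) := by
    have hne : {r : ℝ | ∃ p ∈ closure (orbG G u), ∃ q ∈ closure (orbG G v),
        r = dist p q}.Nonempty :=
      ⟨_, u, subset_closure (mem_orbG_self G u), v, subset_closure (mem_orbG_self G v), rfl⟩
    have hbdd : BddBelow {r : ℝ | ∃ p ∈ closure (orbG G u), ∃ q ∈ closure (orbG G v),
        r = dist p q} := ⟨0, by rintro _ ⟨p, -, q, -, rfl⟩; exact dist_nonneg⟩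
    unfold qd
    rw [hmono.map_csInf_of_continuousAt hcont.continuousAt hne hbdd, orbG_smul, orbG_smul, closure_smul₀, closure_smul₀]
    congr 1
    ext r
    constructor
    · rintro ⟨_, ⟨p, hp, rfl⟩, _, ⟨q, hq, rfl⟩, rfl⟩
      exact ⟨_, ⟨p, hp, q, hq, rfl⟩, hdist p hp q hq⟩
    · rintro ⟨_, ⟨p, hp, q, hq, rfl⟩, rfl⟩
      exact ⟨_, ⟨p, hp, rfl⟩, _, ⟨q, hq, rfl⟩, hdist p hp q hq⟩
  rw [key]
  simp only [hf]
  rw [max_eq_left hqd, Real.sq_sqrt (by positivity)]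
end

section
/- Let S_∞ be the group of bijections ℕ → ℕ acting on ℓ²(ℕ; ℝ) by permutation of indices. The map Φ : ℓ²(ℕ;ℝ)/∕S_∞ → ℓ²(ℕ;ℝ) that interleaves the decreasingly sorted positive part and the negatively-signed decreasingly sorted negative part of x (namely Φ([x])_{2k} = k-th largest entry of x₊ and Φ([x])_{2k−1} = −(k-th largest entry of x₋)) is an isometry: ‖Φ([x]) − Φ([y])‖ = d([x],[y]) for all x, y. Consequently c₂(ℓ²(ℕ;ℝ)/∕S_∞) = 1. -/
open scoped ENNReal

/-- The `(k+1)`-st largest entry of a sequence `x : ℕ → ℝ` (so `kthLargest x 0` is the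
largest entry): the infimum over all `r` that dominate all but `k` of the entries. -/
noncomputable def kthLargest (x : ℕ → ℝ) (k : ℕ) : ℝ :=
  sInf {r : ℝ | ∃ S : Finset ℕ, S.card = k ∧ ∀ i ∉ S, x i ≤ r}

/-- The interleaving map `Φ`: at the `(2k+1)`-st position (0-indexed: odd `n`) it places the
`(k+1)`-st largest entry of the positive part `x₊`, and at the `(2k)`-th position (even `n`)
the negative of the `(k+1)`-st largest entry of the negative part `x₋`. -/
noncomputable def interleaveSorted (x : ℕ → ℝ) : ℕ → ℝ := fun n =>
  if n % 2 = 1 then kthLargest (fun i => max (x i) 0) (n / 2)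
  else - kthLargest (fun i => max (-(x i)) 0) (n / 2)

/-- The orbit of `x ∈ ℓ²(ℕ;ℝ)` under the group `S_∞` of all bijections of `ℕ`. -/
def permOrbit (x : lp (fun _ : ℕ => ℝ) 2) : Set (lp (fun _ : ℕ => ℝ) 2) :=
  {y | ∃ σ : Equiv.Perm ℕ, ∀ i, y i = x (σ i)}

/-- The metric-quotient distance on `ℓ²(ℕ;ℝ)/∕S_∞`: the infimal distance between the
orbit closures. -/
noncomputable def qdPerm (x y : lp (fun _ : ℕ => ℝ) 2) : ℝ :=
  sInf {r : ℝ | ∃ p ∈ closure (permOrbit x), ∃ q ∈ closure (permOrbit y), r = dist p q}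

/-- Euclidean distortion of `(X, ρ)` (see STATEMENT 18). -/
noncomputable def euclideanDistortion (X : Type) (ρ : X → X → ℝ) : ℝ≥0∞ :=
  sInf {c : ℝ≥0∞ | ∃ (κ : Type) (φ : X → lp (fun _ : κ => ℝ) 2) (α β : ℝ), 0 < α ∧
    (∀ x y : X, α * ρ x y ≤ ‖φ x - φ y‖ ∧ ‖φ x - φ y‖ ≤ β * ρ x y) ∧
    ENNReal.ofReal (β / α) ≤ c}

lemma bddBelow_kthLargest {f : ℕ → ℝ} (hf : ∀ i, 0 ≤ f i) (k : ℕ) :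
    BddBelow {r : ℝ | ∃ S : Finset ℕ, S.card = k ∧ ∀ i ∉ S, f i ≤ r} := by
  refine ⟨0, ?_⟩
  rintro r ⟨S, -, hS⟩
  obtain ⟨i, hi⟩ := Infinite.exists_notMem_finset S
  exact (hf i).trans (hS i hi)

lemma kthLargest_nonneg {f : ℕ → ℝ} (hf : ∀ i, 0 ≤ f i) (k : ℕ) : 0 ≤ kthLargest f k := by
  refine Real.sInf_nonneg ?_
  rintro r ⟨S, -, hS⟩
  obtain ⟨i, hi⟩ := Infinite.exists_notMem_finset S
  exact (hf i).trans (hS i hi)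

lemma kthLargest_le {f : ℕ → ℝ} (hf : ∀ i, 0 ≤ f i) {S : Finset ℕ} {r : ℝ}
    (hS : ∀ i ∉ S, f i ≤ r) : kthLargest f S.card ≤ r :=
  csInf_le (bddBelow_kthLargest hf _) ⟨S, rfl, hS⟩

lemma le_kthLargest {f : ℕ → ℝ} (hb : BddAbove (Set.range f)) {T : Finset ℕ} {k : ℕ} {m : ℝ}
    (hT : k < T.card) (hm : ∀ i ∈ T, m ≤ f i) : m ≤ kthLargest f k := by
  refine le_csInf ?_ ?_
  · obtain ⟨b, hb⟩ := hb
    exact ⟨b, Finset.range k, by simp, fun i _ => hb ⟨i, rfl⟩⟩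
  · rintro r ⟨S, rfl, hS⟩
    obtain ⟨i, hiT, hiS⟩ := Finset.exists_mem_notMem_of_card_lt_card hT
    exact (hm i hiT).trans (hS i hiS)

lemma lt_kthLargest_iff {f : ℕ → ℝ} (hf : ∀ i, 0 ≤ f i) (hb : BddAbove (Set.range f))
    (s : ℝ) (k : ℕ) : s < kthLargest f k ↔ (k : ℕ∞) < {i | s < f i}.encard := by
  constructor
  · contrapose!
    intro h
    have hfin : {i | s < f i}.Finite := Set.finite_of_encard_le_coe h
    have hc : hfin.toFinset.card ≤ k := by
      rw [hfin.encard_eq_coe_toFinset_card] at h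
      exact_mod_cast h
    obtain ⟨S, hS, rfl⟩ := Infinite.exists_superset_card_eq hfin.toFinset k hc
    refine kthLargest_le hf fun i hi => ?_
    by_contra! h'
    exact hi (hS (by simpa using h'))
  · intro h
    have h' : ((k + 1 : ℕ) : ℕ∞) ≤ {i | s < f i}.encard := by
      rw [Nat.cast_add, Nat.cast_one]
      exact Order.add_one_le_of_lt h
    obtain ⟨t, hts, htc⟩ := Set.exists_subset_encard_eq h'
    have hfin : t.Finite := Set.finite_of_encard_eq_coe htc
    have hcard : hfin.toFinset.card = k + 1 := by
      rw [hfin.encard_eq_coe_toFinset_card] at htc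
      exact_mod_cast htc
    obtain ⟨j, hj, hmin⟩ := hfin.toFinset.exists_min_image f
      (Finset.card_pos.mp (by omega))
    have hsj : s < f j := hts (by simpa using hj)
    exact hsj.trans_le (le_kthLargest hb (by omega) hmin)

lemma kthLargest_comp_perm (f : ℕ → ℝ) (σ : Equiv.Perm ℕ) (k : ℕ) :
    kthLargest (fun i => f (σ i)) k = kthLargest f k := by
  unfold kthLargest
  congr 1
  ext r
  constructor
  · rintro ⟨S, hS, h⟩
    refine ⟨S.map σ.toEmbedding, by simpa using hS, fun i hi => ?_⟩
    have := h (σ.symm i) (fun h' => hi (by rw [Finset.mem_map_equiv]; exact h'))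
    simpa using this
  · rintro ⟨S, hS, h⟩
    refine ⟨S.map σ.symm.toEmbedding, by simpa using hS, fun i hi => h _ fun h' => hi ?_⟩
    rw [Finset.mem_map_equiv]
    exact h'

lemma encard_setOf_coe_lt (N : ℕ∞) : {k : ℕ | (k : ℕ∞) < N}.encard = N := by
  induction N using ENat.recTopCoe with
  | top => simp
  | coe n =>
    have : {k : ℕ | (k : ℕ∞) < n} = (Finset.range n : Set ℕ) := by ext; simp
    rw [this, Set.encard_coe_eq_coe_finsetCard, Finset.card_range]

lemma encard_lt_kthLargest_inter {f g : ℕ → ℝ} (hf : ∀ i, 0 ≤ f i) (hfb : BddAbove (Set.range f))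
    (hg : ∀ i, 0 ≤ g i) (hgb : BddAbove (Set.range g)) (s t : ℝ) :
    {k | s < kthLargest f k ∧ t < kthLargest g k}.encard
      = min {i | s < f i}.encard {i | t < g i}.encard := by
  simp only [lt_kthLargest_iff hf hfb, lt_kthLargest_iff hg hgb, ← lt_min_iff]
  exact encard_setOf_coe_lt _

open MeasureTheory in
/-- Layer-cake formula for a sum of products. -/
lemma tsum_ofReal_mul_eq_lintegral (f g : ℕ → ℝ) :
    ∑' i, ENNReal.ofReal (f i) * ENNReal.ofReal (g i)
      = ∫⁻ p : ℝ × ℝ, ({i | (0 < p.1 ∧ p.1 < f i) ∧ 0 < p.2 ∧ p.2 < g i}.encard : ℝ≥0∞)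
        ∂(volume.prod volume) := by
  have h (i : ℕ) : ENNReal.ofReal (f i) * ENNReal.ofReal (g i)
      = ∫⁻ p : ℝ × ℝ, (Set.Ioo 0 (f i) ×ˢ Set.Ioo 0 (g i)).indicator 1 p
        ∂(volume.prod volume) := by
    rw [lintegral_indicator_one (measurableSet_Ioo.prod measurableSet_Ioo), Measure.prod_prod]
    simp
  simp_rw [h]
  rw [← lintegral_tsum fun i =>
    (measurable_one.indicator (measurableSet_Ioo.prod measurableSet_Ioo)).aemeasurable]
  refine lintegral_congr fun p => ?_
  rw [← ENNReal.tsum_set_one, tsum_subtype _ (fun _ => (1 : ℝ≥0∞))]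
  refine tsum_congr fun i => ?_
  simp [Set.indicator_apply]

lemma tsum_mul_le_tsum_kthLargest_mul {f g : ℕ → ℝ}
    (hf : ∀ i, 0 ≤ f i) (hfb : BddAbove (Set.range f))
    (hg : ∀ i, 0 ≤ g i) (hgb : BddAbove (Set.range g)) :
    ∑' i, ENNReal.ofReal (f i) * ENNReal.ofReal (g i)
      ≤ ∑' k, ENNReal.ofReal (kthLargest f k) * ENNReal.ofReal (kthLargest g k) := by
  rw [tsum_ofReal_mul_eq_lintegral, tsum_ofReal_mul_eq_lintegral]
  refine MeasureTheory.lintegral_mono fun p => ?_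
  by_cases h : 0 < p.1 ∧ 0 < p.2
  · simp only [h.1, h.2, true_and, encard_lt_kthLargest_inter hf hfb hg hgb]
    exact_mod_cast le_min (Set.encard_le_encard fun i (hi : p.1 < f i ∧ p.2 < g i) => hi.1)
      (Set.encard_le_encard fun i (hi : p.1 < f i ∧ p.2 < g i) => hi.2)
  · have : {i | (0 < p.1 ∧ p.1 < f i) ∧ 0 < p.2 ∧ p.2 < g i} = ∅ := by
      ext i
      simp only [Set.mem_ofPred_eq, Set.mem_empty_iff_false, iff_false]
      tauto
    simp [this]

lemma tsum_kthLargest_sq {f : ℕ → ℝ} (hf : ∀ i, 0 ≤ f i) (hfb : BddAbove (Set.range f)) :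
    ∑' k, ENNReal.ofReal (kthLargest f k) * ENNReal.ofReal (kthLargest f k)
      = ∑' i, ENNReal.ofReal (f i) * ENNReal.ofReal (f i) := by
  refine le_antisymm ?_ (tsum_mul_le_tsum_kthLargest_mul hf hfb hf hfb)
  rw [tsum_ofReal_mul_eq_lintegral, tsum_ofReal_mul_eq_lintegral]
  refine MeasureTheory.lintegral_mono fun p => ?_
  by_cases h : 0 < p.1 ∧ 0 < p.2
  · simp only [h.1, h.2, true_and, encard_lt_kthLargest_inter hf hfb hf hfb]
    norm_cast
    rcases le_total p.1 p.2 with h' | h'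
    · exact (min_le_right _ _).trans (Set.encard_le_encard fun i hi => ⟨h'.trans_lt hi, hi⟩)
    · exact (min_le_left _ _).trans (Set.encard_le_encard fun i hi => ⟨hi, h'.trans_lt hi⟩)
  · have : {i | (0 < p.1 ∧ p.1 < kthLargest f i) ∧ 0 < p.2 ∧ p.2 < kthLargest f i} = ∅ := by
      ext i
      simp only [Set.mem_ofPred_eq, Set.mem_empty_iff_false, iff_false]
      tauto
    simp [this]

lemma hasSum_iff_tsum_ofReal {u : ℕ → ℝ} (hu : ∀ i, 0 ≤ u i) {a : ℝ} (ha : 0 ≤ a) :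
    HasSum u a ↔ ∑' i, ENNReal.ofReal (u i) = ENNReal.ofReal a := by
  constructor
  · intro h
    rw [← h.tsum_eq, ENNReal.ofReal_tsum_of_nonneg hu h.summable]
  · intro h
    have hs : Summable u := by
      have := ENNReal.summable_toReal (f := fun i => ENNReal.ofReal (u i))
        (by rw [h]; exact ENNReal.ofReal_ne_top)
      simpa [ENNReal.toReal_ofReal, hu] using this
    rw [← ENNReal.ofReal_tsum_of_nonneg hu hs,
      ENNReal.ofReal_eq_ofReal_iff (tsum_nonneg hu) ha] at h
    exact h ▸ hs.hasSum

lemma hasSum_kthLargest_sq {f : ℕ → ℝ} (hf : ∀ i, 0 ≤ f i) (hfb : BddAbove (Set.range f)) {a : ℝ}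
    (h : HasSum (fun i => f i * f i) a) :
    HasSum (fun k => kthLargest f k * kthLargest f k) a := by
  have ha : 0 ≤ a := h.nonneg fun i => mul_self_nonneg _
  rw [hasSum_iff_tsum_ofReal (fun i => mul_self_nonneg _) ha] at h ⊢
  simp only [ENNReal.ofReal_mul, hf, kthLargest_nonneg hf] at h ⊢
  rw [tsum_kthLargest_sq hf hfb, h]

lemma le_of_hasSum_kthLargest {f g : ℕ → ℝ} (hf : ∀ i, 0 ≤ f i) (hfb : BddAbove (Set.range f))
    (hg : ∀ i, 0 ≤ g i) (hgb : BddAbove (Set.range g)) {a b : ℝ}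
    (ha : HasSum (fun i => f i * g i) a)
    (hb : HasSum (fun k => kthLargest f k * kthLargest g k) b) : a ≤ b := by
  have ha0 : 0 ≤ a := ha.nonneg fun i => mul_nonneg (hf i) (hg i)
  have hb0 : 0 ≤ b := hb.nonneg fun i => mul_nonneg (kthLargest_nonneg hf i) (kthLargest_nonneg hg i)
  have ha' := (hasSum_iff_tsum_ofReal (fun i => mul_nonneg (hf i) (hg i)) ha0).1 ha
  have hb' := (hasSum_iff_tsum_ofReal
    (fun i => mul_nonneg (kthLargest_nonneg hf i) (kthLargest_nonneg hg i)) hb0).1 hb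
  rw [← ENNReal.ofReal_le_ofReal_iff hb0, ← ha', ← hb']
  simp only [ENNReal.ofReal_mul, hf, kthLargest_nonneg hf]
  exact tsum_mul_le_tsum_kthLargest_mul hf hfb hg hgb

/-- A finite superlevel set `T` can be enumerated so that the values are the largest entries. -/
lemma exists_enum_kthLargest {f : ℕ → ℝ} (hf : ∀ i, 0 ≤ f i) (hfb : BddAbove (Set.range f))
    {s : ℝ} {T : Finset ℕ} (hT : ∀ i, i ∈ T ↔ s < f i) :
    ∃ a : Fin T.card ≃ T, ∀ k : Fin T.card, kthLargest f k = f (a k) := by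
  let e := T.equivFin.symm
  let σ := Tuple.sort fun j => -f (e j)
  have hanti (j k : Fin T.card) (h : j ≤ k) : f (e (σ k)) ≤ f (e (σ j)) :=
    neg_le_neg_iff.mp (Tuple.monotone_sort (fun j => -f (e j)) h)
  let a : Fin T.card ≃ T := σ.trans e
  refine ⟨a, fun k => le_antisymm ?_ ?_⟩
  · let b : Fin T.card ↪ ℕ := a.toEmbedding.trans (Function.Embedding.subtype _)
    have hc : ((Finset.Iio k).map b).card = k := by simp
    rw [← hc]
    refine kthLargest_le hf fun i hi => ?_
    by_cases hiT : i ∈ T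
    · have hk : k ≤ a.symm ⟨i, hiT⟩ := by
        by_contra! h
        exact hi (Finset.mem_map.mpr ⟨a.symm ⟨i, hiT⟩, by simpa using h, by simp [b]⟩)
      have := hanti _ _ hk
      change f (a (a.symm ⟨i, hiT⟩)) ≤ f (a k) at this
      simpa using this
    · rw [hT, not_lt] at hiT
      exact hiT.trans ((hT _).1 (a k).2).le
  · let b : Fin T.card ↪ ℕ := a.toEmbedding.trans (Function.Embedding.subtype _)
    have hc : (k : ℕ) < ((Finset.Iic k).map b).card := by simp
    refine le_kthLargest hfb hc fun i hi => ?_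
    obtain ⟨j, hj, rfl⟩ := Finset.mem_map.mp hi
    exact hanti j k (by simpa using hj)

lemma exists_rank_kthLargest {f : ℕ → ℝ} (hf : ∀ i, 0 ≤ f i) (hfb : BddAbove (Set.range f))
    {s : ℝ} {T : Finset ℕ} (hT : ∀ i, i ∈ T ↔ s < f i) :
    ∃ r : ℕ → ℕ, Set.InjOn r T ∧ ∀ i ∈ T, kthLargest f (r i) = f i := by
  obtain ⟨a, ha⟩ := exists_enum_kthLargest hf hfb hT
  refine ⟨fun i => if h : i ∈ T then a.symm ⟨i, h⟩ else 0, fun i hi j hj h => ?_, fun i hi => ?_⟩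
  · rw [Finset.mem_coe] at hi hj
    simpa [hi, hj, Fin.val_inj] using h
  · simp [hi, ha]

lemma exists_perm_eqOn {T : Finset ℕ} {g : ℕ → ℕ} (hg : Set.InjOn g T) :
    ∃ σ : Equiv.Perm ℕ, ∀ i ∈ T, σ i = g i := by
  have := Equiv.Perm.isMultiplyPretransitive ℕ T.card
  let a : Fin T.card ↪ ℕ := T.equivFin.symm.toEmbedding.trans (Function.Embedding.subtype _)
  let b : Fin T.card ↪ ℕ := ⟨fun j => g (T.equivFin.symm j), fun j k h => by
    simpa [Subtype.val_inj] using hg (T.equivFin.symm j).2 (T.equivFin.symm k).2 h⟩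
  obtain ⟨σ, hσ⟩ := MulAction.exists_smul_eq (Equiv.Perm ℕ) a b
  refine ⟨σ, fun i hi => ?_⟩
  have := DFunLike.congr_fun hσ (T.equivFin ⟨i, hi⟩)
  have hb : b (T.equivFin ⟨i, hi⟩) = g i := by
    change g (T.equivFin.symm (T.equivFin ⟨i, hi⟩)) = g i
    simp
  rw [hb] at this
  simpa [a] using this

lemma lp_two_hasSum_mul {κ : Type*} (x y : lp (fun _ : κ => ℝ) 2) :
    HasSum (fun i => x i * y i) (inner ℝ x y) := by
  simpa [mul_comm] using lp.hasSum_inner (𝕜 := ℝ) x y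

lemma lp_two_abs_apply_le (x : lp (fun _ : ℕ => ℝ) 2) (i : ℕ) : |x i| ≤ ‖x‖ :=
  lp.norm_apply_le_norm (by norm_num) x i

lemma bddAbove_range_posPart (x : lp (fun _ : ℕ => ℝ) 2) :
    BddAbove (Set.range fun i => max (x i) 0) :=
  ⟨‖x‖, by
    rintro _ ⟨i, rfl⟩
    exact max_le ((le_abs_self _).trans (lp_two_abs_apply_le x i)) (norm_nonneg x)⟩

lemma bddAbove_range_negPart (x : lp (fun _ : ℕ => ℝ) 2) :
    BddAbove (Set.range fun i => max (-x i) 0) :=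
  ⟨‖x‖, by
    rintro _ ⟨i, rfl⟩
    exact max_le ((neg_le_abs _).trans (lp_two_abs_apply_le x i)) (norm_nonneg x)⟩

lemma summable_posPart_mul (x y : lp (fun _ : ℕ => ℝ) 2) :
    Summable fun i => max (x i) 0 * max (y i) 0 := by
  refine Summable.of_nonneg_of_le (fun i => by positivity) (fun i => ?_)
    (lp_two_hasSum_mul x y).summable.abs
  rw [abs_mul]
  gcongr
  · exact max_le (le_abs_self _) (abs_nonneg _)
  · exact max_le (le_abs_self _) (abs_nonneg _)

lemma summable_negPart_mul (x y : lp (fun _ : ℕ => ℝ) 2) :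
    Summable fun i => max (-x i) 0 * max (-y i) 0 := by
  simpa using summable_posPart_mul (-x) (-y)

lemma interleaveSorted_even (x : ℕ → ℝ) (k : ℕ) :
    interleaveSorted x (2 * k) = -kthLargest (fun i => max (-(x i)) 0) k := by
  simp [interleaveSorted]

lemma interleaveSorted_odd (x : ℕ → ℝ) (k : ℕ) :
    interleaveSorted x (2 * k + 1) = kthLargest (fun i => max (x i) 0) k := by
  have h : (2 * k + 1) / 2 = k := by omega
  simp [interleaveSorted, Nat.add_mod, h]

lemma hasSum_interleaveSorted_sq (x : lp (fun _ : ℕ => ℝ) 2) :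
    HasSum (fun n => interleaveSorted (fun i => x i) n * interleaveSorted (fun i => x i) n)
      (inner ℝ x x) := by
  have hp := (summable_posPart_mul x x).hasSum
  have hn := (summable_negPart_mul x x).hasSum
  have hsum : inner ℝ x x = (∑' i, max (-x i) 0 * max (-x i) 0)
      + ∑' i, max (x i) 0 * max (x i) 0 := by
    refine (lp_two_hasSum_mul x x).unique ?_
    convert hn.add hp using 2 with i
    rcases le_total (x i) 0 with h | h <;> simp [h]
  rw [hsum]
  refine HasSum.even_add_odd ?_ ?_
  · simpa only [interleaveSorted_even, neg_mul_neg] using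
      hasSum_kthLargest_sq (fun i => le_max_right _ _) (bddAbove_range_negPart x) hn
  · simpa only [interleaveSorted_odd] using
      hasSum_kthLargest_sq (fun i => le_max_right _ _) (bddAbove_range_posPart x) hp

/-- The interleaving map `Φ` with values in `ℓ²`. -/
noncomputable def sortedLp (x : lp (fun _ : ℕ => ℝ) 2) : lp (fun _ : ℕ => ℝ) 2 :=
  ⟨interleaveSorted fun i => x i, (memℓp_gen_iff (by norm_num)).2 (by
    simpa [sq] using (hasSum_interleaveSorted_sq x).summable)⟩

lemma sortedLp_apply (x : lp (fun _ : ℕ => ℝ) 2) (n : ℕ) :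
    sortedLp x n = interleaveSorted (fun i => x i) n := rfl

lemma inner_sortedLp_self (x : lp (fun _ : ℕ => ℝ) 2) :
    inner ℝ (sortedLp x) (sortedLp x) = inner ℝ x x :=
  (lp_two_hasSum_mul _ _).unique (hasSum_interleaveSorted_sq x)

lemma norm_sortedLp (x : lp (fun _ : ℕ => ℝ) 2) : ‖sortedLp x‖ = ‖x‖ := by
  have h := inner_sortedLp_self x
  rwa [real_inner_self_eq_norm_sq, real_inner_self_eq_norm_sq,
    pow_left_inj₀ (norm_nonneg _) (norm_nonneg _) two_ne_zero] at h

/-- The rearrangement inequality for `Φ`. -/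
lemma inner_le_inner_sortedLp (x y : lp (fun _ : ℕ => ℝ) 2) :
    inner ℝ x y ≤ inner ℝ (sortedLp x) (sortedLp y) := by
  have hp := (summable_posPart_mul x y).hasSum
  have hn := (summable_negPart_mul x y).hasSum
  have hS := lp_two_hasSum_mul (sortedLp x) (sortedLp y)
  have hodd : Summable fun k => kthLargest (fun i => max (x i) 0) k *
      kthLargest (fun i => max (y i) 0) k := by
    have := hS.summable.comp_injective
      (i := fun k => 2 * k + 1) (fun a b h => by simpa using h)
    simpa [Function.comp_def, sortedLp_apply, interleaveSorted_odd] using this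
  have heven : Summable fun k => kthLargest (fun i => max (-x i) 0) k *
      kthLargest (fun i => max (-y i) 0) k := by
    have := hS.summable.comp_injective (i := fun k => 2 * k) (fun a b h => by simpa using h)
    simpa [Function.comp_def, sortedLp_apply, interleaveSorted_even] using this
  have hle : inner ℝ x y ≤ (∑' i, max (-x i) 0 * max (-y i) 0)
      + ∑' i, max (x i) 0 * max (y i) 0 := by
    refine hasSum_le (fun i => ?_) (lp_two_hasSum_mul x y) (hn.add hp)
    rcases le_total (x i) 0 with h | h <;> rcases le_total (y i) 0 with h' | h' <;>
      simp [h, h', mul_nonpos_of_nonpos_of_nonneg, mul_nonpos_of_nonneg_of_nonpos]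
  have heq : inner ℝ (sortedLp x) (sortedLp y) = _ := hS.unique <| HasSum.even_add_odd
    (by simpa only [sortedLp_apply, interleaveSorted_even, neg_mul_neg] using heven.hasSum)
    (by simpa only [sortedLp_apply, interleaveSorted_odd] using hodd.hasSum)
  rw [heq]
  refine hle.trans (add_le_add ?_ ?_)
  · exact le_of_hasSum_kthLargest (fun i => le_max_right _ _) (bddAbove_range_negPart x)
      (fun i => le_max_right _ _) (bddAbove_range_negPart y) hn heven.hasSum
  · exact le_of_hasSum_kthLargest (fun i => le_max_right _ _) (bddAbove_range_posPart x)
      (fun i => le_max_right _ _) (bddAbove_range_posPart y) hp hodd.hasSum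

lemma dist_sortedLp_le (x y : lp (fun _ : ℕ => ℝ) 2) :
    dist (sortedLp x) (sortedLp y) ≤ dist x y := by
  rw [dist_eq_norm, dist_eq_norm]
  refine (sq_le_sq₀ (norm_nonneg _) (norm_nonneg _)).1 ?_
  rw [norm_sub_sq_real, norm_sub_sq_real, norm_sortedLp, norm_sortedLp]
  linarith [inner_le_inner_sortedLp x y]

lemma sortedLp_eq_of_mem_permOrbit {x y : lp (fun _ : ℕ => ℝ) 2} (h : y ∈ permOrbit x) :
    sortedLp y = sortedLp x := by
  obtain ⟨σ, hσ⟩ := h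
  ext n
  simp only [sortedLp_apply, interleaveSorted, hσ]
  rw [kthLargest_comp_perm (fun i => max (x i) 0), kthLargest_comp_perm (fun i => max (-x i) 0)]

lemma sortedLp_eq_of_mem_closure {x y : lp (fun _ : ℕ => ℝ) 2} (h : y ∈ closure (permOrbit x)) :
    sortedLp y = sortedLp x := by
  have hcont : Continuous sortedLp :=
    (LipschitzWith.of_dist_le_mul (K := 1) fun x y => by simpa using dist_sortedLp_le x y).continuous
  exact closure_minimal (fun z hz => sortedLp_eq_of_mem_permOrbit hz)
    (isClosed_eq hcont continuous_const) h

lemma finite_lt_abs (x : lp (fun _ : ℕ => ℝ) 2) {s : ℝ} (hs : 0 < s) : {i | s < |x i|}.Finite := by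
  have h := (lp_two_hasSum_mul x x).summable.tendsto_cofinite_zero.eventually
    (gt_mem_nhds (mul_pos hs hs))
  refine (Filter.eventually_cofinite.1 h).subset fun i (hi : s < |x i|) => ?_
  change ¬ (x i * x i < s * s)
  rw [← abs_mul_abs_self (x i), not_lt]
  exact mul_self_le_mul_self hs.le hi.le

/-- Finitely many nonzero entries of `x` can be moved to their positions in `Φ x`. -/
lemma exists_perm_interleaveSorted (x : lp (fun _ : ℕ => ℝ) 2) {F : Finset ℕ}
    (hF : ∀ i ∈ F, x i ≠ 0) : ∃ σ : Equiv.Perm ℕ, ∀ i ∈ F, sortedLp x (σ i) = x i := by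
  obtain ⟨s, hsF, hs⟩ : ∃ s : ℝ, (∀ i ∈ F, s < |x i|) ∧ 0 < s := by
    have h : ∀ᶠ s in nhdsWithin (0 : ℝ) (Set.Ioi 0), ∀ i ∈ F, s < |x i| :=
      (Finset.eventually_all F).2 fun i hi =>
        Filter.Eventually.filter_mono nhdsWithin_le_nhds (gt_mem_nhds (abs_pos.2 (hF i hi)))
    exact (h.and self_mem_nhdsWithin).exists
  have hp : {i | s < max (x i) 0}.Finite := (finite_lt_abs x hs).subset fun i
    (hi : s < max (x i) 0) => hi.trans_le (max_le (le_abs_self _) (abs_nonneg _))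
  have hn : {i | s < max (-x i) 0}.Finite := (finite_lt_abs x hs).subset fun i
    (hi : s < max (-x i) 0) => hi.trans_le (max_le (neg_le_abs _) (abs_nonneg _))
  obtain ⟨r, hr, hr'⟩ := exists_rank_kthLargest (T := hp.toFinset) (s := s)
    (fun i => le_max_right (x i) 0) (bddAbove_range_posPart x) (by simp)
  obtain ⟨q, hq, hq'⟩ := exists_rank_kthLargest (T := hn.toFinset) (s := s)
    (fun i => le_max_right (-x i) 0) (bddAbove_range_negPart x) (by simp)
  have hpos (i : ℕ) (hi : i ∈ F) (h : 0 < x i) : i ∈ hp.toFinset := by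
    have := hsF i hi
    rw [abs_of_pos h] at this
    simp [this]
  have hneg (i : ℕ) (hi : i ∈ F) (h : ¬ 0 < x i) : i ∈ hn.toFinset := by
    have := hsF i hi
    rw [abs_of_nonpos (not_lt.1 h)] at this
    simp [this]
  obtain ⟨σ, hσ⟩ := exists_perm_eqOn (T := F)
    (g := fun i => if 0 < x i then 2 * r i + 1 else 2 * q i) (by
      intro i hi j hj hij
      rw [Finset.mem_coe] at hi hj
      by_cases h : 0 < x i <;> by_cases h' : 0 < x j <;> simp only [h, h', if_true, if_false] at hij
      · exact hr (hpos i hi h) (hpos j hj h') (by omega)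
      · omega
      · omega
      · exact hq (hneg i hi h) (hneg j hj h') (by omega))
  refine ⟨σ, fun i hi => ?_⟩
  rw [hσ i hi, sortedLp_apply]
  split_ifs with h
  · rw [interleaveSorted_odd, hr' i (hpos i hi h), max_eq_left h.le]
  · rw [interleaveSorted_even, hq' i (hneg i hi h), max_eq_left (by linarith), neg_neg]

lemma sortedLp_mem_closure_permOrbit (x : lp (fun _ : ℕ => ℝ) 2) :
    sortedLp x ∈ closure (permOrbit x) := by
  rw [Metric.mem_closure_iff]
  intro ε hε
  have hx := lp_two_hasSum_mul x x
  obtain ⟨F, hF⟩ : ∃ F : Finset ℕ, inner ℝ x x - ε ^ 2 / 4 < ∑ i ∈ F, x i * x i :=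
    (hx.eventually (lt_mem_nhds (sub_lt_self _ (by positivity)))).exists
  obtain ⟨σ, hσ⟩ := exists_perm_interleaveSorted x (F := F.filter fun i => x i ≠ 0) (by simp)
  have hz : Memℓp (fun i => x (σ.symm i)) 2 := (memℓp_gen_iff (by norm_num)).2 (by
    simpa [sq, Function.comp_def] using σ.symm.summable_iff.2 hx.summable)
  let z : lp (fun _ : ℕ => ℝ) 2 := ⟨fun i => x (σ.symm i), hz⟩
  refine ⟨z, ⟨σ.symm, fun i => rfl⟩, ?_⟩
  have hd := σ.hasSum_iff.2 (lp_two_hasSum_mul (sortedLp x - z) (sortedLp x - z))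
  have hS := σ.hasSum_iff.2 (lp_two_hasSum_mul (sortedLp x) (sortedLp x))
  have hfin : HasSum (fun i => if i ∈ F then x i * x i else 0) (∑ i ∈ F, x i * x i) := by
    rw [← Finset.sum_congr rfl fun i hi => if_pos hi]
    exact hasSum_sum_of_ne_finset_zero fun i hi => if_neg hi
  have hle := hasSum_le (fun i => ?_) hd
    (((hS.mul_left 2).add (hx.mul_left 2)).sub (hfin.mul_left 4))
  · rw [inner_sortedLp_self, real_inner_self_eq_norm_sq] at hle
    rw [dist_eq_norm]
    refine lt_of_pow_lt_pow_left₀ 2 hε.le ?_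
    linarith
  · have hzi : z (σ i) = x i := by simp [z]
    simp only [Function.comp_apply, lp.coeFn_sub, Pi.sub_apply, hzi]
    by_cases hi : i ∈ F
    · by_cases h0 : x i = 0
      · simp only [h0, hi, if_true]
        nlinarith [mul_self_nonneg (sortedLp x (σ i))]
      · rw [hσ i (by simp [hi, h0])]
        simp only [hi, if_true]
        linarith
    · simp only [hi, if_false]
      nlinarith [mul_self_nonneg (sortedLp x (σ i) + x i)]

lemma qdPerm_eq_dist_sortedLp (x y : lp (fun _ : ℕ => ℝ) 2) :
    qdPerm x y = dist (sortedLp x) (sortedLp y) := by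
  have hmem : dist (sortedLp x) (sortedLp y) ∈
      {r : ℝ | ∃ p ∈ closure (permOrbit x), ∃ q ∈ closure (permOrbit y), r = dist p q} :=
    ⟨_, sortedLp_mem_closure_permOrbit x, _, sortedLp_mem_closure_permOrbit y, rfl⟩
  have hlow : dist (sortedLp x) (sortedLp y) ∈ lowerBounds
      {r : ℝ | ∃ p ∈ closure (permOrbit x), ∃ q ∈ closure (permOrbit y), r = dist p q} := by
    rintro r ⟨p, hp, q, hq, rfl⟩
    rw [← sortedLp_eq_of_mem_closure hp, ← sortedLp_eq_of_mem_closure hq]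
    exact dist_sortedLp_le p q
  exact IsLeast.csInf_eq ⟨hmem, hlow⟩

/-- the interleaving-sorting map `Φ` is an isometry of `ℓ²(ℕ;ℝ)/∕S_∞` into
`ℓ²(ℕ;ℝ)`, and consequently `c₂(ℓ²(ℕ;ℝ)/∕S_∞) = 1`. -/
theorem sorting_isometry_and_distortion_one :
    (∀ x y : lp (fun _ : ℕ => ℝ) 2,
      Real.sqrt (∑' n : ℕ,
        (interleaveSorted (fun i => x i) n - interleaveSorted (fun i => y i) n) ^ 2)
        = qdPerm x y) ∧
    euclideanDistortion (lp (fun _ : ℕ => ℝ) 2) qdPerm = 1 := by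
  refine ⟨fun x y => ?_, le_antisymm ?_ ?_⟩
  · have h := (lp_two_hasSum_mul (sortedLp x - sortedLp y) (sortedLp x - sortedLp y)).tsum_eq
    simp only [lp.coeFn_sub, Pi.sub_apply, sortedLp_apply, ← sq] at h
    rw [h, real_inner_self_eq_norm_sq, Real.sqrt_sq (norm_nonneg _), qdPerm_eq_dist_sortedLp,
      dist_eq_norm]
  · refine sInf_le ⟨ℕ, sortedLp, 1, 1, one_pos, fun x y => ?_, by simp⟩
    simp [qdPerm_eq_dist_sortedLp, dist_eq_norm]
  · refine le_sInf ?_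
    rintro c ⟨κ, φ, α, β, hα, h, hc⟩
    refine le_trans ?_ hc
    obtain ⟨y, hy⟩ : ∃ y : lp (fun _ : ℕ => ℝ) 2, y ≠ 0 :=
      ⟨lp.single 2 0 1, fun h0 => by simpa using congrArg (fun z : lp (fun _ : ℕ => ℝ) 2 => z 0) h0⟩
    have hpos : 0 < qdPerm y 0 := by
      have h0 : sortedLp 0 = 0 := norm_eq_zero.1 (by rw [norm_sortedLp, norm_zero])
      rw [qdPerm_eq_dist_sortedLp, h0, dist_zero_right, norm_sortedLp]
      exact norm_pos_iff.2 hy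
    have hαβ : α ≤ β := le_of_mul_le_mul_right ((h y 0).1.trans (h y 0).2) hpos
    rw [ENNReal.one_le_ofReal]
    exact (one_le_div hα).2 hαβ
end
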